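/- Let V be a real normed vector space and S ⊆ V a subset whose Kolmogorov n-widths decay at most algebraically, i.e., there exist M > 0 and α > 0 with d_m(S;V) ≥ M · m^(−α) for all m ≥ 1. Then for every p ≥ 2 and every n ≥ 4, the polynomial manifold (n,p)-width satisfies δ^poly_{n,p}(S;V) ≥ M · n^(−αp). -/

import Mathlib

open scoped ENNReal NNReal

noncomputable section

variable {V : Type*} [NormedAddCommGroup V] [NormedSpace ℝ V]

/-- Worst best-approximation error of `S` in `T`, valued in `[0,∞]`:
`dist(S,T) = sup_{s ∈ S} inf_{t ∈ T} ‖s - t‖`. -/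
def distSet (S T : Set V) : ℝ≥0∞ :=
  ⨆ s ∈ S, ⨅ t ∈ T, (‖s - t‖₊ : ℝ≥0∞)

/-- Kolmogorov `n`-width: infimum of `dist(S,U)` over linear subspaces `U` of dimension
at most `n`. -/
def kolWidth (n : ℕ) (S : Set V) : ℝ≥0∞ :=
  ⨅ (U : Submodule ℝ V) (_ : Module.rank ℝ U ≤ n), distSet S (U : Set V)

/-- Multi-indices on `Fin l` of total degree at most `p`. -/
def multiIndices (l p : ℕ) : Finset (Fin l → ℕ) :=
  (Fintype.piFinset fun _ => Finset.range (p + 1)).filter fun α => ∑ i, α i ≤ p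

/-- `D : ℝ^l → V` is a polynomial mapping of degree `p`:
`D x = Σ_{|α| ≤ p} x^α • v_α` for some coefficient vectors `v_α ∈ V`. -/
def IsPolyMap {l : ℕ} (p : ℕ) (D : (Fin l → ℝ) → V) : Prop :=
  ∃ v : (Fin l → ℕ) → V, ∀ x, D x = ∑ α ∈ multiIndices l p, (∏ i, x i ^ α i) • v α

/-- `s(n,p) = Σ_{k=0}^p C(n+k-1, k)`, the number of multi-indices of degree at most `p`. -/
def sTot (n p : ℕ) : ℕ := ∑ k ∈ Finset.range (p + 1), Nat.choose (n + k - 1) k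

/-- Polynomial Kolmogorov `(n,p)`-width: infimum of `dist(S, image D)` over `l ≤ n` and
polynomial mappings `D` of degree `p` on `ℝ^l`. -/
def polyKolWidth (n p : ℕ) (S : Set V) : ℝ≥0∞ :=
  ⨅ (l : ℕ) (_ : l ≤ n) (D : (Fin l → ℝ) → V) (_ : IsPolyMap p D),
    distSet S (Set.range D)

/-- Polynomial manifold `(n,p)`-width: infimum over `l ≤ n`, polynomial mappings `D` of
degree `p` on `ℝ^l` and continuous encoders `e : V → ℝ^l` of `sup_{s ∈ S} ‖s - D (e s)‖`. -/
def polyManiWidth (n p : ℕ) (S : Set V) : ℝ≥0∞ :=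
  ⨅ (l : ℕ) (_ : l ≤ n) (D : (Fin l → ℝ) → V) (_ : IsPolyMap p D)
    (e : V → (Fin l → ℝ)) (_ : Continuous e),
    ⨆ s ∈ S, (‖s - D (e s)‖₊ : ℝ≥0∞)

theorem card_multiIndices_le (l p : ℕ) : (multiIndices l p).card ≤ (l + p).choose p := by
  have h1 : (Finset.finsuppAntidiag (Finset.univ : Finset (Fin (l + 1))) p).card
      = (l + p).choose p := by
    rw [Finset.card_finsuppAntidiag_nat_eq_choose]
    simp only [Finset.card_univ, Fintype.card_fin]
    congr 1
    omega
  rw [← h1]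
  apply Finset.card_le_card_of_injOn (fun a : Fin l → ℕ => Finsupp.equivFunOnFinite.symm
    (Fin.cons (α := fun _ => ℕ) (p - ∑ i, a i) a))
  · intro a ha
    simp only [multiIndices, Finset.coe_filter, Set.mem_setOf_eq] at ha
    simp only [Finset.mem_coe, Finset.mem_finsuppAntidiag, Fin.sum_univ_succ,
      Finsupp.equivFunOnFinite_symm_apply_apply, Fin.cons_zero, Fin.cons_succ]
    refine ⟨by omega, Finset.subset_univ _⟩
  · intro a _ b _ hab
    exact (Fin.cons_inj.1 (Finsupp.equivFunOnFinite.symm.injective hab)).2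

theorem choose_le_pow_aux (n p : ℕ) (hp : 2 ≤ p) (hn : 4 ≤ n) : (n + p).choose p ≤ n ^ p := by
  induction p, hp using Nat.le_induction with
  | base =>
    have h := Nat.add_one_mul_choose_eq (n + 1) 1
    simp only [Nat.choose_one_right] at h
    have e : n + 1 + 1 = n + 2 := rfl
    simp only [e] at h
    norm_num at h
    nlinarith
  | succ p hp ih =>
    have h := Nat.add_one_mul_choose_eq (n + p) p
    have e : n + p + 1 = n + (p + 1) := rfl
    simp only [e] at h
    have h2 : n + (p + 1) ≤ n * (p + 1) := by nlinarith
    have h3 : (n + (p + 1)).choose (p + 1) * (p + 1) ≤ n ^ (p + 1) * (p + 1) := by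
      rw [← h]
      calc (n + (p + 1)) * (n + p).choose p ≤ (n * (p + 1)) * n ^ p := Nat.mul_le_mul h2 ih
        _ = n ^ (p + 1) * (p + 1) := by ring
    exact Nat.le_of_mul_le_mul_right h3 (Nat.succ_pos p)

/-- if the Kolmogorov widths of `S` decay at most algebraically, i.e.
`d_m(S;V) ≥ M m^{-α}` for all `m ≥ 1`, then for `p ≥ 2` and `n ≥ 4` the polynomial
manifold `(n,p)`-width satisfies `δ^poly_{n,p}(S;V) ≥ M n^{-αp}`. -/
theorem stmt10 (V : Type*) [NormedAddCommGroup V] [NormedSpace ℝ V]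
    (S : Set V) (M α : ℝ) (hM : 0 < M) (hα : 0 < α)
    (h : ∀ m : ℕ, 1 ≤ m → ENNReal.ofReal (M * (m : ℝ) ^ (-α)) ≤ kolWidth m S)
    (p n : ℕ) (hp : 2 ≤ p) (hn : 4 ≤ n) :
    ENNReal.ofReal (M * (n : ℝ) ^ (-(α * (p : ℝ)))) ≤ polyManiWidth n p S := by
  classical
  have hcast : M * (n : ℝ) ^ (-(α * (p : ℝ))) = M * ((n ^ p : ℕ) : ℝ) ^ (-α) := by
    rw [Nat.cast_pow, ← Real.rpow_natCast, ← Real.rpow_mul (Nat.cast_nonneg n)]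
    congr 2
    ring
  rw [hcast]
  refine (h (n ^ p) (Nat.one_le_pow _ _ (by omega))).trans ?_
  unfold polyManiWidth
  refine le_iInf fun l => le_iInf fun hl => le_iInf fun D => le_iInf fun hD => le_iInf fun e =>
    le_iInf fun _ => ?_
  obtain ⟨v, hv⟩ := hD
  let T : Finset V := (multiIndices l p).image v
  have hT : T.card ≤ n ^ p := calc
    T.card ≤ (multiIndices l p).card := Finset.card_image_le
    _ ≤ (l + p).choose p := card_multiIndices_le l p
    _ ≤ (n + p).choose p := Nat.choose_le_choose p (by omega)
    _ ≤ n ^ p := choose_le_pow_aux n p hp hn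
  have hr : Module.rank ℝ (Submodule.span ℝ (T : Set V)) ≤ ((n ^ p : ℕ) : Cardinal) :=
    (rank_span_finset_le T).trans (by exact_mod_cast hT)
  refine (iInf₂_le (Submodule.span ℝ (T : Set V)) hr).trans ?_
  refine iSup₂_mono fun s _ => iInf₂_le (D (e s)) ?_
  rw [hv]
  refine Submodule.sum_mem _ fun a ha => Submodule.smul_mem _ _ (Submodule.subset_span ?_)
  exact Finset.mem_coe.2 (Finset.mem_image_of_mem v ha)

end
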